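/- arXiv:1912.04222 — 3 statements merged into one kernel-verified Lean document; each statement's English description precedes it below -/
import Mathlib

section
/- Let O be a finite nonempty set, ε ≥ 0 a real number, and u : O → ℝ a utility function. Let p_o = p_{ε,u}(o) be the probability that the exponential mechanism outputs o, and let p'_o = P_{ε,u}(o) be the probability that the randomized rounding exponential mechanism outputs o. Then for every o ∈ O, p_o · exp(−2ε) ≤ p'_o ≤ p_o · exp(2ε). -/
open MeasureTheory

/-- Randomized rounding of `v` with randomness `s`. -/
noncomputable def rround (s v : ℝ) : ℝ :=
  if s < v - (⌊v⌋ : ℝ) then (⌈v⌉ : ℝ) else (⌊v⌋ : ℝ)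

/-- Probability that the randomized rounding exponential mechanism outputs `o`. -/
noncomputable def rrProb {O : Type*} [Fintype O] (ε : ℝ) (u : O → ℝ) (o : O) : ℝ :=
  ∫ s : O → ℝ,
    Real.exp (-ε * rround (s o) (u o)) /
      (∑ o' : O, Real.exp (-ε * rround (s o') (u o')))
    ∂(Measure.pi fun _ : O => volume.restrict (Set.Ico (0 : ℝ) 1))

theorem measurable_rround (v : ℝ) : Measurable fun s => rround s v :=
  Measurable.ite measurableSet_Iio measurable_const measurable_const

theorem abs_rround_sub_le_one (s v : ℝ) : |rround s v - v| ≤ 1 := by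
  have h₁ := Int.floor_le v
  have h₂ := Int.lt_floor_add_one v
  have h₃ := Int.le_ceil v
  have h₄ := Int.ceil_lt_add_one v
  unfold rround
  split_ifs <;> rw [abs_le] <;> constructor <;> linarith

/-- The exponential mechanism changes by a factor of at most `exp (2ε)` when every utility
changes by at most one. -/
theorem exp_div_sum_exp_le {O : Type*} [Fintype O] {ε : ℝ} (hε : 0 ≤ ε) {v w : O → ℝ}
    (h : ∀ o, |v o - w o| ≤ 1) (o : O) :
    Real.exp (-ε * v o) / (∑ o', Real.exp (-ε * v o')) ≤
      (Real.exp (-ε * w o) / (∑ o', Real.exp (-ε * w o'))) * Real.exp (2 * ε) := by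
  have : Nonempty O := ⟨o⟩
  have hnum : Real.exp (-ε * v o) ≤ Real.exp (-ε * w o) * Real.exp ε := by
    rw [← Real.exp_add, Real.exp_le_exp]
    nlinarith [(abs_le.mp (h o)).1]
  have hden : (∑ o', Real.exp (-ε * w o')) ≤ (∑ o', Real.exp (-ε * v o')) * Real.exp ε := by
    rw [Finset.sum_mul]
    refine Finset.sum_le_sum fun o' _ => ?_
    rw [← Real.exp_add, Real.exp_le_exp]
    nlinarith [(abs_le.mp (h o')).2]
  have hv : 0 < ∑ o', Real.exp (-ε * v o') :=
    Finset.sum_pos (fun _ _ => Real.exp_pos _) Finset.univ_nonempty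
  have hw : 0 < ∑ o', Real.exp (-ε * w o') :=
    Finset.sum_pos (fun _ _ => Real.exp_pos _) Finset.univ_nonempty
  rw [div_mul_eq_mul_div, div_le_div_iff₀ hv hw]
  calc Real.exp (-ε * v o) * ∑ o', Real.exp (-ε * w o')
      ≤ (Real.exp (-ε * w o) * Real.exp ε) * ((∑ o', Real.exp (-ε * v o')) * Real.exp ε) := by
        gcongr
    _ = Real.exp (-ε * w o) * Real.exp (2 * ε) * ∑ o', Real.exp (-ε * v o') := by
        rw [two_mul, Real.exp_add]
        ring

/-- The randomized rounding exponential mechanism probability of each outcome is within a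
factor of `exp (2ε)` of the unrounded exponential mechanism probability. -/
theorem randomized_rounding_close_to_exponential_mechanism
    {O : Type*} [Fintype O] [Nonempty O] (ε : ℝ) (hε : 0 ≤ ε) (u : O → ℝ) :
    ∀ o : O,
      (Real.exp (-ε * u o) / (∑ o' : O, Real.exp (-ε * u o'))) * Real.exp (-2 * ε) ≤
          rrProb ε u o ∧
        rrProb ε u o ≤
          (Real.exp (-ε * u o) / (∑ o' : O, Real.exp (-ε * u o'))) * Real.exp (2 * ε) := by
  intro o
  have : IsProbabilityMeasure (volume.restrict (Set.Ico (0 : ℝ) 1)) := ⟨by simp⟩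
  have hupper (s : O → ℝ) := exp_div_sum_exp_le hε (v := fun o => rround (s o) (u o)) (w := u)
    (fun o => abs_rround_sub_le_one (s o) (u o)) o
  have hlower (s : O → ℝ) :
      (Real.exp (-ε * u o) / (∑ o' : O, Real.exp (-ε * u o'))) * Real.exp (-2 * ε) ≤
        Real.exp (-ε * rround (s o) (u o)) /
          (∑ o' : O, Real.exp (-ε * rround (s o') (u o'))) := by
    rw [neg_mul 2, Real.exp_neg, ← div_eq_mul_inv, div_le_iff₀ (Real.exp_pos _)]
    refine exp_div_sum_exp_le hε (v := u) (w := fun o => rround (s o) (u o)) (fun o => ?_) o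
    rw [abs_sub_comm]
    exact abs_rround_sub_le_one (s o) (u o)
  have hexp (o' : O) : Measurable fun s : O → ℝ => Real.exp (-ε * rround (s o') (u o')) :=
    (((measurable_rround (u o')).comp (measurable_pi_apply o')).const_mul (-ε)).exp
  have hint : Integrable (fun s : O → ℝ => Real.exp (-ε * rround (s o) (u o)) /
      (∑ o' : O, Real.exp (-ε * rround (s o') (u o'))))
      (Measure.pi fun _ : O => volume.restrict (Set.Ico (0 : ℝ) 1)) := by
    refine Integrable.of_bound ((hexp o).div
      (Finset.univ.measurable_fun_sum fun o' _ => hexp o')).aestronglyMeasurable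
      ((Real.exp (-ε * u o) / (∑ o' : O, Real.exp (-ε * u o'))) * Real.exp (2 * ε))
      (Filter.Eventually.of_forall fun s => ?_)
    rw [Real.norm_of_nonneg (by positivity)]
    exact hupper s
  constructor
  · simpa [rrProb] using integral_mono (integrable_const _) hint hlower
  · simpa [rrProb] using integral_mono hint (integrable_const _) hupper
end

section
/- Let O be a finite set with at least two elements, ε ≥ 0 a real number, u : O → ℝ a utility function, and o₁, o₂ ∈ O with u(o₁) ≤ u(o₂) (equivalently, the exponential mechanism assigns o₁ probability at least that of o₂). Then the randomized rounding exponential mechanism also assigns o₁ probability at least that of o₂: P_{ε,u}(o₁) ≥ P_{ε,u}(o₂). (Monotonicity of randomized rounding.) -/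
open MeasureTheory

/-- For randomness in `[0, 1)`, randomized rounding is the ceiling of the shifted value. -/
theorem rround_eq_ceil_sub {s : ℝ} (hs : s ∈ Set.Ico (0 : ℝ) 1) (v : ℝ) :
    rround s v = (⌈v - s⌉ : ℝ) := by
  obtain ⟨h0, h1⟩ := hs
  have hf := Int.floor_le v
  have hf' := Int.lt_floor_add_one v
  unfold rround
  split_ifs with h
  · have e₁ : ⌈v⌉ = ⌊v⌋ + 1 := by
      rw [Int.ceil_eq_iff]; push_cast; constructor <;> linarith
    have e₂ : ⌈v - s⌉ = ⌊v⌋ + 1 := by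
      rw [Int.ceil_eq_iff]; push_cast; constructor <;> linarith
    rw [e₁, e₂]
  · have e : ⌈v - s⌉ = ⌊v⌋ := by
      rw [Int.ceil_eq_iff]; constructor <;> linarith
    rw [e]

theorem rround_mono {s : ℝ} (hs : s ∈ Set.Ico (0 : ℝ) 1) : Monotone (rround s) := by
  intro v w h
  rw [rround_eq_ceil_sub hs, rround_eq_ceil_sub hs]
  exact_mod_cast Int.ceil_mono (sub_le_sub_right h s)

theorem integrable_exp_rround_div_sum {O : Type*} [Fintype O] (ε : ℝ) (u : O → ℝ) (o : O)
    (μ : Measure (O → ℝ)) [IsFiniteMeasure μ] :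
    Integrable (fun s : O → ℝ => Real.exp (-ε * rround (s o) (u o)) /
      ∑ o' : O, Real.exp (-ε * rround (s o') (u o'))) μ := by
  have hm : ∀ o' : O, Measurable fun s : O → ℝ => Real.exp (-ε * rround (s o') (u o')) :=
    fun o' => (((measurable_rround (u o')).comp (measurable_pi_apply o')).const_mul (-ε)).exp
  refine Integrable.of_bound
    ((hm o).div (Finset.measurable_fun_sum _ fun o' _ => hm o')).aestronglyMeasurable 1
    (Filter.Eventually.of_forall fun s => ?_)
  rw [Real.norm_of_nonneg (by positivity)]
  exact div_le_one_of_le₀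
    (Finset.single_le_sum (f := fun o' => Real.exp (-ε * rround (s o') (u o')))
      (fun _ _ => (Real.exp_pos _).le) (Finset.mem_univ o))
    (by positivity)

/-- The output probability may be computed with the randomness permuted among the outcomes. -/
theorem rrProb_apply_perm {O : Type*} [Fintype O] (ε : ℝ) (u : O → ℝ) (e : Equiv.Perm O) (o : O) :
    rrProb ε u (e o) = ∫ s : O → ℝ,
      Real.exp (-ε * rround (s o) (u (e o))) /
        (∑ o' : O, Real.exp (-ε * rround (s o') (u (e o'))))
      ∂(Measure.pi fun _ : O => volume.restrict (Set.Ico (0 : ℝ) 1)) := by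
  have hp := measurePreserving_piCongrLeft (α := fun _ : O => ℝ)
    (fun _ : O => volume.restrict (Set.Ico (0 : ℝ) 1)) e
  unfold rrProb
  rw [← hp.integral_comp']
  congr 1
  ext s
  rw [← Equiv.sum_comp e]
  simp only [MeasurableEquiv.coe_piCongrLeft, Equiv.piCongrLeft_apply_apply]

/-- Monotonicity of randomized rounding: if `u o₁ ≤ u o₂`, then the randomized rounding
exponential mechanism assigns `o₁` probability at least that of `o₂`. -/
theorem randomized_rounding_monotone
    {O : Type*} [Fintype O] [Nontrivial O] (ε : ℝ) (hε : 0 ≤ ε) (u : O → ℝ)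
    (o₁ o₂ : O) (h : u o₁ ≤ u o₂) :
    rrProb ε u o₂ ≤ rrProb ε u o₁ := by
  classical
  have hswap := rrProb_apply_perm ε u (Equiv.swap o₁ o₂) o₁
  rw [Equiv.swap_apply_left] at hswap
  rw [hswap]
  refine integral_mono_of_nonneg (Filter.Eventually.of_forall fun s => by positivity)
    (integrable_exp_rround_div_sum ε u o₁ _) ?_
  have hs : ∀ᵐ s : O → ℝ ∂(Measure.pi fun _ : O => volume.restrict (Set.Ico (0 : ℝ) 1)),
      ∀ o, s o ∈ Set.Ico (0 : ℝ) 1 :=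
    ae_all_iff.2 fun o => (Measure.tendsto_eval_ae_ae (i := o)).eventually
      (ae_restrict_mem measurableSet_Ico)
  filter_upwards [hs] with s hs
  have hexp : ∀ (o : O) {v w : ℝ}, v ≤ w →
      Real.exp (-ε * rround (s o) w) ≤ Real.exp (-ε * rround (s o) v) := fun o _ _ hvw =>
    Real.exp_le_exp.2 (mul_le_mul_of_nonpos_left (rround_mono (hs o) hvw) (neg_nonpos.2 hε))
  have hrest : ∑ o ∈ Finset.univ.erase o₁, Real.exp (-ε * rround (s o) (u o)) ≤
      ∑ o ∈ Finset.univ.erase o₁, Real.exp (-ε * rround (s o) (u (Equiv.swap o₁ o₂ o))) := by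
    refine Finset.sum_le_sum fun o ho => hexp o ?_
    rcases eq_or_ne o o₂ with rfl | ho₂
    · rwa [Equiv.swap_apply_right]
    · rw [Equiv.swap_apply_of_ne_of_ne (Finset.ne_of_mem_erase ho) ho₂]
  have hnum := hexp o₁ h
  rw [← Finset.add_sum_erase _ _ (Finset.mem_univ o₁),
    ← Finset.add_sum_erase _ (fun o => Real.exp (-ε * rround (s o) (u o))) (Finset.mem_univ o₁),
    Equiv.swap_apply_left, div_le_div_iff₀ (by positivity) (by positivity), mul_add, mul_add,
    mul_comm (Real.exp (-ε * rround (s o₁) (u o₂)))]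
  gcongr
end

section
/- Let O be a finite set with at least two elements, ε ≥ 0 a real number, u : O → ℝ a utility function, and o* ∈ O. For each o ∈ O define f_o = u(o) − ⌊u(o)⌋, E_o = f_o·exp(−ε·⌈u(o)⌉) + (1 − f_o)·exp(−ε·⌊u(o)⌋), M_o = ∑_{o' ∈ O, o' ≠ o} E_{o'}, and q_o = (1 − f_o)·exp(−ε·⌊u(o)⌋)/(exp(−ε·⌊u(o)⌋) + M_o) + f_o·exp(−ε·⌈u(o)⌉)/(exp(−ε·⌈u(o)⌉) + M_o). Let A = 1 − ∑_{o ∈ O} q_o and B = p_{ε,u}(o*) − q_{o*}, where p_{ε,u} is the (unrounded) exponential mechanism distribution. Then the difference between the probability that the randomized rounding exponential mechanism outputs o* and the probability that the exponential mechanism outputs o* is bounded: |P_{ε,u}(o*) − p_{ε,u}(o*)| ≤ A + |B|. -/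
open MeasureTheory

theorem comp_rround (φ : ℝ → ℝ) (s v : ℝ) :
    φ (rround s v) = if s < v - (⌊v⌋ : ℝ) then φ (⌈v⌉ : ℝ) else φ (⌊v⌋ : ℝ) := by
  unfold rround
  split_ifs <;> rfl

theorem measurable_comp_rround (φ : ℝ → ℝ) (v : ℝ) :
    Measurable fun s : ℝ => φ (rround s v) := by
  simp only [comp_rround]
  exact Measurable.ite measurableSet_Iio measurable_const measurable_const

instance isProbabilityMeasure_restrict_Ico_zero_one :
    IsProbabilityMeasure (volume.restrict (Set.Ico (0 : ℝ) 1)) :=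
  ⟨by simp⟩

theorem abs_comp_rround_le (φ : ℝ → ℝ) (s v : ℝ) :
    |φ (rround s v)| ≤ |φ (⌈v⌉ : ℝ)| + |φ (⌊v⌋ : ℝ)| := by
  rw [comp_rround φ]
  have h₁ := abs_nonneg (φ (⌈v⌉ : ℝ))
  have h₂ := abs_nonneg (φ (⌊v⌋ : ℝ))
  split_ifs <;> linarith

theorem integral_comp_rround (φ : ℝ → ℝ) (v : ℝ) :
    ∫ s in Set.Ico (0 : ℝ) 1, φ (rround s v) =
      (v - (⌊v⌋ : ℝ)) * φ (⌈v⌉ : ℝ) + (1 - (v - (⌊v⌋ : ℝ))) * φ (⌊v⌋ : ℝ) := by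
  have h₀ : 0 ≤ v - (⌊v⌋ : ℝ) := sub_nonneg.2 (Int.floor_le v)
  have h₁ : v - (⌊v⌋ : ℝ) < 1 := by linarith [Int.lt_floor_add_one v]
  set c := v - (⌊v⌋ : ℝ) with hc
  have hI : IntegrableOn (fun s => φ (rround s v)) (Set.Ico (0 : ℝ) 1) :=
    Integrable.of_bound (measurable_comp_rround φ v).aestronglyMeasurable _
      (Filter.Eventually.of_forall fun s => abs_comp_rround_le φ s v)
  have hU : Set.Ico (0 : ℝ) 1 = Set.Ico 0 c ∪ Set.Ico c 1 :=
    (Set.Ico_union_Ico_eq_Ico h₀ h₁.le).symm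
  have hD : Disjoint (Set.Ico (0 : ℝ) c) (Set.Ico c 1) :=
    Set.disjoint_left.2 fun x hx hx' => absurd hx.2 (not_lt.2 hx'.1)
  rw [hU] at hI ⊢
  rw [setIntegral_union hD measurableSet_Ico hI.left_of_union hI.right_of_union]
  have e₁ : ∫ s in Set.Ico (0 : ℝ) c, φ (rround s v) = ∫ s in Set.Ico (0 : ℝ) c, φ (⌈v⌉ : ℝ) :=
    setIntegral_congr_fun measurableSet_Ico fun s hs => by
      simp only [comp_rround]; exact if_pos hs.2
  have e₂ : ∫ s in Set.Ico c 1, φ (rround s v) = ∫ s in Set.Ico c 1, φ (⌊v⌋ : ℝ) :=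
    setIntegral_congr_fun measurableSet_Ico fun s hs => by
      simp only [comp_rround]; exact if_neg (not_lt.2 hs.1)
  rw [e₁, e₂]
  simp [h₀, h₁.le]

/-- Tangent line bound for the convex function `y ↦ x / (x + y)` at `y = m`. -/
theorem div_add_tangent_le {x y m : ℝ} (hx : 0 < x) (hy : 0 ≤ y) (hm : 0 ≤ m) :
    x / (x + m) - x / (x + m) ^ 2 * (y - m) ≤ x / (x + y) := by
  have h₁ : 0 < x + m := by positivity
  have h₂ : 0 < x + y := by positivity
  have h : x / (x + y) - (x / (x + m) - x / (x + m) ^ 2 * (y - m)) =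
      x * (y - m) ^ 2 / ((x + y) * (x + m) ^ 2) := by
    field_simp
    ring
  have : 0 ≤ x * (y - m) ^ 2 / ((x + y) * (x + m) ^ 2) := by positivity
  linarith

section Pi

variable {O : Type*}

theorem measurable_comp_rround_eval (φ : ℝ → ℝ) (v : ℝ) (o : O) :
    Measurable fun s : O → ℝ => φ (rround (s o) v) :=
  (measurable_comp_rround φ v).comp (measurable_pi_apply o)

variable [Fintype O]

theorem integrable_comp_rround_eval (φ : ℝ → ℝ) (v : ℝ) (o : O) :
    Integrable (fun s : O → ℝ => φ (rround (s o) v))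
      (Measure.pi fun _ : O => volume.restrict (Set.Ico (0 : ℝ) 1)) :=
  Integrable.of_bound (measurable_comp_rround_eval φ v o).aestronglyMeasurable _
    (Filter.Eventually.of_forall fun s => abs_comp_rround_le φ (s o) v)

theorem integral_comp_rround_eval (φ : ℝ → ℝ) (v : ℝ) (o : O) :
    ∫ s : O → ℝ, φ (rround (s o) v)
        ∂(Measure.pi fun _ : O => volume.restrict (Set.Ico (0 : ℝ) 1)) =
      (v - (⌊v⌋ : ℝ)) * φ (⌈v⌉ : ℝ) + (1 - (v - (⌊v⌋ : ℝ))) * φ (⌊v⌋ : ℝ) := by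
  rw [← integral_comp_rround]
  exact integral_comp_eval (μ := fun _ : O => volume.restrict (Set.Ico (0 : ℝ) 1))
    (measurable_comp_rround φ v).aestronglyMeasurable

theorem indepFun_comp_rround_eval (φ ψ : ℝ → ℝ) (v w : ℝ) {o o' : O} (h : o ≠ o') :
    ProbabilityTheory.IndepFun (fun s : O → ℝ => φ (rround (s o) v))
      (fun s : O → ℝ => ψ (rround (s o') w))
      (Measure.pi fun _ : O => volume.restrict (Set.Ico (0 : ℝ) 1)) := by
  have hi : ProbabilityTheory.iIndepFun (fun (i : O) (s : O → ℝ) => s i)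
      (Measure.pi fun _ : O => volume.restrict (Set.Ico (0 : ℝ) 1)) :=
    ProbabilityTheory.iIndepFun_pi (X := fun _ x => x) fun _ => aemeasurable_id
  exact (hi.indepFun h).comp (measurable_comp_rround φ v) (measurable_comp_rround ψ w)

theorem integrable_rrProb (ε : ℝ) (u : O → ℝ) (o : O) :
    Integrable (fun s : O → ℝ => Real.exp (-ε * rround (s o) (u o)) /
        (∑ o' : O, Real.exp (-ε * rround (s o') (u o'))))
      (Measure.pi fun _ : O => volume.restrict (Set.Ico (0 : ℝ) 1)) := by
  have hm (o' : O) : Measurable fun s : O → ℝ => Real.exp (-ε * rround (s o') (u o')) :=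
    measurable_comp_rround_eval (fun r => Real.exp (-ε * r)) (u o') o'
  refine Integrable.of_bound
    ((hm o).div (Finset.measurable_fun_sum _ fun o' _ => hm o')).aestronglyMeasurable 1
    (Filter.Eventually.of_forall fun s => ?_)
  rw [Real.norm_of_nonneg (by positivity)]
  exact div_le_one_of_le₀ (Finset.single_le_sum
    (f := fun o' => Real.exp (-ε * rround (s o') (u o')))
    (fun _ _ => (Real.exp_pos _).le) (Finset.mem_univ o)) (by positivity)

theorem sum_rrProb [Nonempty O] (ε : ℝ) (u : O → ℝ) : ∑ o : O, rrProb ε u o = 1 := by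
  unfold rrProb
  rw [← integral_finsetSum _ fun o _ => integrable_rrProb ε u o]
  have h (s : O → ℝ) : ∑ o : O, Real.exp (-ε * rround (s o) (u o)) /
      (∑ o' : O, Real.exp (-ε * rround (s o') (u o'))) = 1 := by
    rw [← Finset.sum_div]
    exact div_self (Finset.sum_pos (fun _ _ => Real.exp_pos _) Finset.univ_nonempty).ne'
  simp only [h]
  simp

/-- Jensen's inequality: replacing the weights of the other outcomes by their expectations
lowers the probability of an outcome. -/
theorem le_rrProb [DecidableEq O] (ε : ℝ) (u : O → ℝ) (o : O) {E : O → ℝ} {m : ℝ}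
    (hE : ∀ o', E o' = (u o' - (⌊u o'⌋ : ℝ)) * Real.exp (-ε * (⌈u o'⌉ : ℝ)) +
      (1 - (u o' - (⌊u o'⌋ : ℝ))) * Real.exp (-ε * (⌊u o'⌋ : ℝ)))
    (hm : m = ∑ o' ∈ Finset.univ.erase o, E o') :
    (u o - (⌊u o⌋ : ℝ)) * (Real.exp (-ε * (⌈u o⌉ : ℝ)) / (Real.exp (-ε * (⌈u o⌉ : ℝ)) + m)) +
      (1 - (u o - (⌊u o⌋ : ℝ))) *
        (Real.exp (-ε * (⌊u o⌋ : ℝ)) / (Real.exp (-ε * (⌊u o⌋ : ℝ)) + m)) ≤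
      rrProb ε u o := by
  have hm₀ : 0 ≤ m := by
    rw [hm]
    refine Finset.sum_nonneg fun o' _ => ?_
    rw [hE]
    have h₀ : 0 ≤ u o' - (⌊u o'⌋ : ℝ) := sub_nonneg.2 (Int.floor_le _)
    have h₁ : 0 ≤ 1 - (u o' - (⌊u o'⌋ : ℝ)) := by linarith [Int.lt_floor_add_one (u o')]
    positivity
  let w : ℝ → ℝ := fun r => Real.exp (-ε * r)
  let φ : ℝ → ℝ := fun r => w r / (w r + m)
  let ψ : ℝ → ℝ := fun r => w r / (w r + m) ^ 2
  let μ := Measure.pi fun _ : O => volume.restrict (Set.Ico (0 : ℝ) 1)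
  have hφ : Integrable (fun s : O → ℝ => φ (rround (s o) (u o))) μ :=
    integrable_comp_rround_eval φ (u o) o
  have hψ : Integrable (fun s : O → ℝ => ψ (rround (s o) (u o)) * m) μ :=
    (integrable_comp_rround_eval ψ (u o) o).mul_const m
  have hprod : ∀ o' ∈ Finset.univ.erase o, Integrable
      (fun s : O → ℝ => ψ (rround (s o) (u o)) * w (rround (s o') (u o'))) μ := fun o' ho' =>
    (indepFun_comp_rround_eval ψ w (u o) (u o') (Finset.ne_of_mem_erase ho').symm).integrable_mul
      (integrable_comp_rround_eval ψ (u o) o) (integrable_comp_rround_eval w (u o') o')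
  have hprod_eq : ∀ o' ∈ Finset.univ.erase o,
      ∫ s : O → ℝ, ψ (rround (s o) (u o)) * w (rround (s o') (u o')) ∂μ =
        (∫ s : O → ℝ, ψ (rround (s o) (u o)) ∂μ) * E o' := fun o' ho' => by
    rw [hE, ← integral_comp_rround_eval w (u o') o']
    exact (indepFun_comp_rround_eval ψ w (u o) (u o')
      (Finset.ne_of_mem_erase ho').symm).integral_fun_mul_eq_mul_integral
      (measurable_comp_rround_eval ψ (u o) o).aestronglyMeasurable
      (measurable_comp_rround_eval w (u o') o').aestronglyMeasurable
  have hsum := integrable_finsetSum _ hprod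
  have hint : ∫ s : O → ℝ, (φ (rround (s o) (u o)) -
      ((∑ o' ∈ Finset.univ.erase o, ψ (rround (s o) (u o)) * w (rround (s o') (u o'))) -
        ψ (rround (s o) (u o)) * m)) ∂μ = ∫ s : O → ℝ, φ (rround (s o) (u o)) ∂μ := by
    rw [integral_sub hφ (by exact hsum.sub hψ), integral_sub hsum hψ, integral_finsetSum _ hprod,
      Finset.sum_congr rfl hprod_eq, ← Finset.mul_sum, ← hm, integral_mul_const]
    ring
  calc _ = ∫ s : O → ℝ, φ (rround (s o) (u o)) ∂μ :=
        (integral_comp_rround_eval φ (u o) o).symm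
    _ ≤ rrProb ε u o := by
        rw [← hint]
        refine integral_mono (hφ.sub (hsum.sub hψ)) (integrable_rrProb ε u o) fun s => ?_
        have ht := div_add_tangent_le (Real.exp_pos (-ε * rround (s o) (u o)))
          (Finset.sum_nonneg (s := Finset.univ.erase o)
            (f := fun o' => Real.exp (-ε * rround (s o') (u o')))
            fun _ _ => (Real.exp_pos _).le) hm₀
        rw [Finset.add_sum_erase _ (fun o' => Real.exp (-ε * rround (s o') (u o')))
          (Finset.mem_univ o)] at ht
        simpa only [← Finset.mul_sum, ← mul_sub] using ht

end Pi

open Finset in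
/-- Accuracy of randomized rounding: the pointwise difference between the randomized rounding
exponential mechanism and the unrounded exponential mechanism is bounded by `A + |B|`. -/
theorem randomized_rounding_accuracy_bound
    {O : Type*} [Fintype O] [Nontrivial O] [DecidableEq O]
    (ε : ℝ) (hε : 0 ≤ ε) (u : O → ℝ) (ostar : O)
    (f E M q : O → ℝ) (p : O → ℝ) (A B : ℝ)
    (hf : ∀ o : O, f o = u o - (⌊u o⌋ : ℝ))
    (hE : ∀ o : O, E o =
      f o * Real.exp (-ε * (⌈u o⌉ : ℝ)) + (1 - f o) * Real.exp (-ε * (⌊u o⌋ : ℝ)))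
    (hM : ∀ o : O, M o = ∑ o' ∈ Finset.univ.erase o, E o')
    (hq : ∀ o : O, q o =
      (1 - f o) * Real.exp (-ε * (⌊u o⌋ : ℝ)) /
          (Real.exp (-ε * (⌊u o⌋ : ℝ)) + M o) +
        f o * Real.exp (-ε * (⌈u o⌉ : ℝ)) /
          (Real.exp (-ε * (⌈u o⌉ : ℝ)) + M o))
    (hp : ∀ o : O, p o = Real.exp (-ε * u o) / (∑ o' : O, Real.exp (-ε * u o')))
    (hA : A = 1 - ∑ o : O, q o)
    (hB : B = p ostar - q ostar) :
    |rrProb ε u ostar - p ostar| ≤ A + |B| := by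
  have hle (o : O) : q o ≤ rrProb ε u o := by
    have h := le_rrProb ε u o (E := E) (m := M o) (fun o' => by rw [hE, hf]) (hM o)
    rw [hq, hf, mul_div_assoc, mul_div_assoc]
    linarith
  have hsum : rrProb ε u ostar - q ostar ≤ A := by
    rw [hA, ← sum_rrProb ε u, ← Finset.sum_sub_distrib]
    exact Finset.single_le_sum (f := fun o => rrProb ε u o - q o)
      (fun o _ => sub_nonneg.2 (hle o)) (Finset.mem_univ ostar)
  have h : rrProb ε u ostar - p ostar = (rrProb ε u ostar - q ostar) - B := by
    rw [hB]; ring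
  rw [h]
  calc |(rrProb ε u ostar - q ostar) - B| ≤ |rrProb ε u ostar - q ostar| + |B| := abs_sub _ _
    _ ≤ A + |B| := by
      rw [abs_of_nonneg (sub_nonneg.2 (hle ostar))]
      linarith
end
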